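/- Fix a finite sequence of positive integers (a_1,…,a_n). For every ε > 0 there exists an integer m_0 > 0 such that for every m ≥ m_0 and every positive integer N, one has |Φ⁻(β^N) − Φ⁻(β^{N+1})| < ε/2, where Φ⁻(γ) = Φ(γ) − α_1(γ)α_2(γ)⋯α_{n+m−1}(γ)·log(1/α_{n+m}(γ)) is the Brjuno sum with its (n+m)-th term removed. -/

import Mathlib

open scoped Real ENNReal
open Filter

/-- The Gauss-map iterates: `alphaIter θ k` is `α_{k+1}(θ)`, i.e. `alphaIter θ 0 = α_1(θ) = θ`
and `α_{i+1}(θ)` is the fractional part of `1/α_i(θ)`. -/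
noncomputable def alphaIter (θ : ℝ) : ℕ → ℝ
  | 0 => θ
  | k + 1 => Int.fract (1 / alphaIter θ k)

/-- `HasCF θ a` : `θ` is an irrational number in `(0,1)` whose continued fraction digits
are given by `a` (0-indexed: `a k` is the digit `a_{k+1}` in 1-indexed notation). -/
def HasCF (θ : ℝ) (a : ℕ → ℕ) : Prop :=
  θ ∈ Set.Ioo (0 : ℝ) 1 ∧ Irrational θ ∧ ∀ k, ⌊1 / alphaIter θ k⌋ = (a k : ℤ)

/-- Yoccoz's Brjuno function `Φ(θ) = Σ_{n≥1} α_1(θ)⋯α_{n-1}(θ)·log(1/α_n(θ))`,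
as a real-valued sum. -/
noncomputable def brjunoPhi (θ : ℝ) : ℝ :=
  ∑' k : ℕ, (∏ j ∈ Finset.range k, alphaIter θ j) * Real.log (1 / alphaIter θ k)

/-- Yoccoz's Brjuno function with values in `ℝ≥0∞` (all terms are nonnegative). -/
noncomputable def brjunoPhiE (θ : ℝ) : ℝ≥0∞ :=
  ∑' k : ℕ, ENNReal.ofReal ((∏ j ∈ Finset.range k, alphaIter θ j) * Real.log (1 / alphaIter θ k))

/-- Digits of the noble number `ω = [a_1,…,a_n,1,1,1,…]`. -/
def nobleDigits (n : ℕ) (a : ℕ → ℕ) : ℕ → ℕ := fun k => if k < n then a k else 1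

/-- Digits of `β^N = [a_1,…,a_n,1,…,1,N,1,1,…]`, with `N` in (1-indexed) position `n+m`. -/
def betaDigits (n m N : ℕ) (a : ℕ → ℕ) : ℕ → ℕ :=
  fun k => if k + 1 = n + m then N else if k < n then a k else 1

/-- Digits of `β^I = [a_1,…,a_n,1,…,1,b_{n+m},b_{n+m+1},…]`: the digits of the noble number
with the whole tail from (1-indexed) position `n+m` on replaced by the tail `b`. -/
def tailDigits (n m : ℕ) (a b : ℕ → ℕ) : ℕ → ℕ :=
  fun k => if k + 1 < n + m then (if k < n then a k else 1) else b k

/-- The Brjuno sum with its `(n+m)`-th term removed: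
`Φ⁻(γ) = Φ(γ) - α_1(γ)⋯α_{n+m-1}(γ)·log(1/α_{n+m}(γ))`. -/
noncomputable def brjunoPhiMinus (n m : ℕ) (γ : ℝ) : ℝ :=
  brjunoPhi γ -
    (∏ j ∈ Finset.range (n + m - 1), alphaIter γ j) * Real.log (1 / alphaIter γ (n + m - 1))

/-- The term `α_1(θ)⋯α_k(θ)·log(1/α_{k+1}(θ))` of Yoccoz's Brjuno function. -/
noncomputable def brjunoTerm (θ : ℝ) (k : ℕ) : ℝ :=
  (∏ j ∈ Finset.range k, alphaIter θ j) * Real.log (1 / alphaIter θ k)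

/-- A product of numbers of `(0,1)`, any two consecutive of which have product at most `1/2`,
decays geometrically. -/
lemma prod_range_le_two_mul_pow {u : ℕ → ℝ} (h0 : ∀ k, 0 < u k) (h1 : ∀ k, u k < 1)
    (h2 : ∀ k, u k * u (k + 1) ≤ 1 / 2) (k : ℕ) :
    ∏ j ∈ Finset.range k, u j ≤ 2 * (3 / 4 : ℝ) ^ k := by
  induction k using Nat.twoStepInduction with
  | zero => norm_num
  | one => simpa using (h1 0).le.trans (by norm_num)
  | more k ih _ =>
    rw [Finset.prod_range_succ, Finset.prod_range_succ, mul_assoc]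
    calc _ ≤ (2 * (3 / 4 : ℝ) ^ k) * (1 / 2) := by
          gcongr
          · exact mul_nonneg (h0 _).le (h0 _).le
          · exact h2 k
      _ ≤ 2 * (3 / 4 : ℝ) ^ (k + 2) := by
          rw [pow_add]
          nlinarith [pow_pos (by norm_num : (0 : ℝ) < 3 / 4) k]

lemma abs_prod_range_sub_prod_range_le {u v : ℕ → ℝ} (hu0 : ∀ k, 0 ≤ u k) (hu1 : ∀ k, u k ≤ 1)
    (hv0 : ∀ k, 0 ≤ v k) (hv1 : ∀ k, v k ≤ 1) (k : ℕ) :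
    |∏ j ∈ Finset.range k, u j - ∏ j ∈ Finset.range k, v j|
      ≤ ∑ j ∈ Finset.range k, |u j - v j| := by
  induction k with
  | zero => simp
  | succ k ih =>
    rw [Finset.prod_range_succ, Finset.prod_range_succ, Finset.sum_range_succ]
    set P := ∏ j ∈ Finset.range k, u j
    set Q := ∏ j ∈ Finset.range k, v j with hQ
    have hQ0 : 0 ≤ Q := Finset.prod_nonneg fun j _ => hv0 j
    have hQ1 : Q ≤ 1 := Finset.prod_le_one (fun j _ => hv0 j) fun j _ => hv1 j
    calc |P * u k - Q * v k| = |(P - Q) * u k + Q * (u k - v k)| := by ring_nf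
      _ ≤ |(P - Q) * u k| + |Q * (u k - v k)| := abs_add_le _ _
      _ = |P - Q| * u k + Q * |u k - v k| := by
          rw [abs_mul, abs_mul, abs_of_nonneg (hu0 k), abs_of_nonneg hQ0]
      _ ≤ |P - Q| + |u k - v k| :=
          add_le_add (mul_le_of_le_one_right (abs_nonneg _) (hu1 k))
            (mul_le_of_le_one_left (abs_nonneg _) hQ1)
      _ ≤ _ := by gcongr

lemma abs_log_sub_log_le {x y c : ℝ} (hx : 0 < x) (hy : 0 < y) (hcx : 1 / x ≤ c)
    (hcy : 1 / y ≤ c) : |Real.log x - Real.log y| ≤ c * |x - y| := by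
  wlog h : y ≤ x generalizing x y
  · rw [abs_sub_comm, abs_sub_comm x]
    exact this hy hx hcy hcx (le_of_not_ge h)
  rw [abs_of_nonneg (sub_nonneg.2 (Real.log_le_log hy h)), abs_of_nonneg (sub_nonneg.2 h),
    ← Real.log_div hx.ne' hy.ne']
  calc Real.log (x / y) ≤ x / y - 1 := Real.log_le_sub_one_of_pos (by positivity)
    _ = 1 / y * (x - y) := by field_simp
    _ ≤ c * (x - y) := mul_le_mul_of_nonneg_right hcy (sub_nonneg.2 h)

namespace HasCF

variable {θ η : ℝ} {d e : ℕ → ℕ}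

lemma irrational_alphaIter (h : HasCF θ d) (k : ℕ) : Irrational (alphaIter θ k) := by
  induction k with
  | zero => exact h.2.1
  | succ k ih =>
    change Irrational (Int.fract (1 / alphaIter θ k))
    rw [Int.fract, one_div]
    exact ih.inv.sub_intCast _

lemma alphaIter_mem_Ioo (h : HasCF θ d) (k : ℕ) : alphaIter θ k ∈ Set.Ioo (0 : ℝ) 1 := by
  cases k with
  | zero => exact h.1
  | succ k =>
    exact ⟨lt_of_le_of_ne (Int.fract_nonneg _) (h.irrational_alphaIter (k + 1)).ne_zero.symm,
      Int.fract_lt_one _⟩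

lemma alphaIter_pos (h : HasCF θ d) (k : ℕ) : 0 < alphaIter θ k := (h.alphaIter_mem_Ioo k).1

lemma alphaIter_lt_one (h : HasCF θ d) (k : ℕ) : alphaIter θ k < 1 := (h.alphaIter_mem_Ioo k).2

lemma one_div_alphaIter (h : HasCF θ d) (k : ℕ) :
    1 / alphaIter θ k = d k + alphaIter θ (k + 1) := by
  have := Int.floor_add_fract (1 / alphaIter θ k)
  rw [h.2.2 k] at this
  exact_mod_cast this.symm

lemma one_le_digit (h : HasCF θ d) (k : ℕ) : (1 : ℝ) ≤ d k := by
  have h1 : (1 : ℤ) ≤ d k := by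
    rw [← h.2.2 k, Int.le_floor, Int.cast_one]
    exact (one_le_one_div (h.alphaIter_pos k) (h.alphaIter_lt_one k).le)
  exact_mod_cast h1

lemma alphaIter_mul_succ_le (h : HasCF θ d) (k : ℕ) :
    alphaIter θ k * alphaIter θ (k + 1) ≤ 1 / 2 := by
  have h0 := h.alphaIter_pos k
  have h1 : alphaIter θ k * (d k + alphaIter θ (k + 1)) = 1 := by
    rw [← h.one_div_alphaIter k, mul_one_div_cancel h0.ne']
  nlinarith [h.one_le_digit k, h.alphaIter_lt_one (k + 1)]

lemma prod_alphaIter_le (h : HasCF θ d) (s k : ℕ) :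
    ∏ j ∈ Finset.range k, alphaIter θ (s + j) ≤ 2 * (3 / 4 : ℝ) ^ k :=
  prod_range_le_two_mul_pow (fun _ => h.alphaIter_pos _) (fun _ => h.alphaIter_lt_one _)
    (fun j => h.alphaIter_mul_succ_le (s + j)) k

lemma one_div_alphaIter_le (h : HasCF θ d) (k : ℕ) : 1 / alphaIter θ k ≤ d k + 1 := by
  rw [h.one_div_alphaIter k]
  exact add_le_add_right (h.alphaIter_lt_one (k + 1)).le _

lemma log_nonneg (h : HasCF θ d) (k : ℕ) : 0 ≤ Real.log (1 / alphaIter θ k) :=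
  Real.log_nonneg (one_le_one_div (h.alphaIter_pos k) (h.alphaIter_lt_one k).le)

lemma log_le (h : HasCF θ d) (k : ℕ) : Real.log (1 / alphaIter θ k) ≤ d k := by
  have h1 := Real.log_le_sub_one_of_pos (one_div_pos.2 (h.alphaIter_pos k))
  linarith [h.one_div_alphaIter_le k]

lemma abs_brjunoTerm_le (h : HasCF θ d) {k : ℕ} {A : ℝ} (hA : (d k : ℝ) ≤ A) :
    |brjunoTerm θ k| ≤ 2 * A * (3 / 4 : ℝ) ^ k := by
  have hp : 0 ≤ ∏ j ∈ Finset.range k, alphaIter θ j :=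
    Finset.prod_nonneg fun j _ => (h.alphaIter_pos j).le
  have hP : ∏ j ∈ Finset.range k, alphaIter θ j ≤ 2 * (3 / 4 : ℝ) ^ k := by
    simpa using h.prod_alphaIter_le 0 k
  rw [brjunoTerm, abs_of_nonneg (mul_nonneg hp (h.log_nonneg k))]
  calc _ ≤ (2 * (3 / 4 : ℝ) ^ k) * A :=
        mul_le_mul hP ((h.log_le k).trans hA) (h.log_nonneg k) (by positivity)
    _ = _ := by ring

lemma summable_brjunoTerm (h : HasCF θ d) {A : ℝ} (hA : ∀ k, (d k : ℝ) ≤ A) :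
    Summable (brjunoTerm θ) :=
  Summable.of_norm_bounded
    ((summable_geometric_of_lt_one (by norm_num) (by norm_num)).mul_left (2 * A))
    fun k => h.abs_brjunoTerm_le (hA k)

lemma abs_alphaIter_sub_le_prod (h : HasCF θ d) (h' : HasCF η e) (L k : ℕ)
    (hde : ∀ j < L, d (k + j) = e (k + j)) :
    |alphaIter θ k - alphaIter η k| ≤ ∏ j ∈ Finset.range L, alphaIter θ (k + j) := by
  induction L generalizing k with
  | zero =>
    rw [Finset.prod_range_zero, abs_le]
    constructor <;> linarith [h.alphaIter_pos k, h.alphaIter_lt_one k, h'.alphaIter_pos k,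
      h'.alphaIter_lt_one k]
  | succ L ih =>
    have ih' := ih (k + 1) fun j hj => by
      simpa [add_assoc, add_comm 1 j] using hde (j + 1) (by omega)
    have hx := h.alphaIter_pos k
    have hy := h'.alphaIter_pos k
    have hd : d k = e k := hde 0 (by omega)
    have hsub : alphaIter θ k - alphaIter η k
        = alphaIter θ k * alphaIter η k * (alphaIter η (k + 1) - alphaIter θ (k + 1)) := by
      have e1 := h.one_div_alphaIter k
      have e2 := h'.one_div_alphaIter k
      rw [← hd] at e2
      have e3 : alphaIter η (k + 1) - alphaIter θ (k + 1)
          = 1 / alphaIter η k - 1 / alphaIter θ k := by rw [e1, e2]; ring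
      rw [e3]
      field_simp
    rw [Finset.prod_range_succ', hsub, abs_mul, abs_of_pos (mul_pos hx hy), abs_sub_comm]
    calc _ ≤ alphaIter θ k * |alphaIter θ (k + 1) - alphaIter η (k + 1)| := by
          gcongr
          exact mul_le_of_le_one_right hx.le (h'.alphaIter_lt_one k).le
      _ ≤ alphaIter θ k * ∏ j ∈ Finset.range L, alphaIter θ (k + 1 + j) := by gcongr
      _ = _ := by
          rw [mul_comm]
          simp only [add_zero, add_assoc, add_comm 1]

lemma abs_alphaIter_sub_le (h : HasCF θ d) (h' : HasCF η e) {k K : ℕ}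
    (hde : ∀ j < K, d j = e j) :
    |alphaIter θ k - alphaIter η k| ≤ 2 * (3 / 4 : ℝ) ^ (K - k) :=
  (h.abs_alphaIter_sub_le_prod h' (K - k) k fun j hj => hde _ (by omega)).trans
    (h.prod_alphaIter_le k _)

lemma abs_brjunoTerm_sub_le (h : HasCF θ d) (h' : HasCF η e) {k : ℕ} {A : ℝ}
    (hA : (d k : ℝ) ≤ A) (hA' : (e k : ℝ) ≤ A) :
    |brjunoTerm θ k - brjunoTerm η k|
      ≤ (∑ j ∈ Finset.range k, |alphaIter θ j - alphaIter η j|) * A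
        + (A + 1) * |alphaIter θ k - alphaIter η k| := by
  have hprod := abs_prod_range_sub_prod_range_le (fun j => (h.alphaIter_pos j).le)
    (fun j => (h.alphaIter_lt_one j).le) (fun j => (h'.alphaIter_pos j).le)
    (fun j => (h'.alphaIter_lt_one j).le) k
  have hlog := abs_log_sub_log_le (h.alphaIter_pos k) (h'.alphaIter_pos k) (c := A + 1)
    ((h.one_div_alphaIter_le k).trans (by gcongr)) ((h'.one_div_alphaIter_le k).trans (by gcongr))
  have hl0 := h.log_nonneg k
  have hlA := (h.log_le k).trans hA
  unfold brjunoTerm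
  set P := ∏ j ∈ Finset.range k, alphaIter θ j
  set Q := ∏ j ∈ Finset.range k, alphaIter η j
  have hQ0 : 0 ≤ Q := Finset.prod_nonneg fun j _ => (h'.alphaIter_pos j).le
  have hQ1 : Q ≤ 1 :=
    Finset.prod_le_one (fun j _ => (h'.alphaIter_pos j).le) fun j _ => (h'.alphaIter_lt_one j).le
  simp only [one_div, Real.log_inv] at hl0 hlA ⊢
  set l := Real.log (alphaIter θ k)
  set l' := Real.log (alphaIter η k)
  calc |P * -l - Q * -l'| = |(P - Q) * -l + Q * (l' - l)| := by ring_nf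
    _ ≤ |(P - Q) * -l| + |Q * (l' - l)| := abs_add_le _ _
    _ = |P - Q| * -l + Q * |l - l'| := by
        rw [abs_mul, abs_mul, abs_of_nonneg hl0, abs_of_nonneg hQ0, abs_sub_comm l']
    _ ≤ _ := add_le_add (mul_le_mul hprod hlA hl0 ((abs_nonneg _).trans hprod))
        ((mul_le_of_le_one_left (abs_nonneg _) hQ1).trans hlog)

end HasCF

lemma betaDigits_le_of_ne {n m N k : ℕ} (a : ℕ → ℕ) (hk : k + 1 ≠ n + m) :
    betaDigits n m N a k ≤ 1 + ∑ i ∈ Finset.range n, a i := by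
  rw [betaDigits, if_neg hk]
  split_ifs with h
  · have := Finset.single_le_sum (f := a) (fun i _ => Nat.zero_le _) (Finset.mem_range.2 h)
    omega
  · omega

lemma summable_brjunoTerm_of_betaDigits {n m N : ℕ} {a : ℕ → ℕ} {θ : ℝ}
    (h : HasCF θ (betaDigits n m N a)) : Summable (brjunoTerm θ) := by
  refine h.summable_brjunoTerm (A := (N + (1 + ∑ i ∈ Finset.range n, a i) : ℕ)) fun k => ?_
  rw [Nat.cast_le]
  by_cases hk : k + 1 = n + m
  · rw [betaDigits, if_pos hk]
    omega
  · exact (betaDigits_le_of_ne a hk).trans (Nat.le_add_left _ _)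

lemma brjunoPhiMinus_eq_tsum {n m : ℕ} {θ : ℝ} (h : Summable (brjunoTerm θ)) :
    brjunoPhiMinus n m θ = ∑' k, if k = n + m - 1 then 0 else brjunoTerm θ k :=
  sub_eq_iff_eq_add'.2 (h.tsum_eq_add_tsum_ite (n + m - 1))

lemma brjunoPhiMinus_sub_eq_tsum {n m : ℕ} {θ η : ℝ} (h : Summable (brjunoTerm θ))
    (h' : Summable (brjunoTerm η)) :
    brjunoPhiMinus n m θ - brjunoPhiMinus n m η
      = ∑' k, if k = n + m - 1 then 0 else brjunoTerm θ k - brjunoTerm η k := by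
  have aux {f : ℕ → ℝ} (hf : Summable f) :
      Summable fun k => if k = n + m - 1 then 0 else f k := by
    refine hf.abs.of_norm_bounded fun k => ?_
    split_ifs <;> simp
  rw [brjunoPhiMinus_eq_tsum h, brjunoPhiMinus_eq_tsum h', ← (aux h).tsum_sub (aux h')]
  congr 1 with k
  split_ifs <;> simp

/-- Lemma `lem6`: for `m` large enough, `|Φ⁻(β^N) - Φ⁻(β^{N+1})| < ε/2` for all `N`. -/
theorem phiMinus_close_to_succ
    (n : ℕ) (a : ℕ → ℕ) (ha : ∀ i < n, 0 < a i)
    (ε : ℝ) (hε : 0 < ε) :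
    ∃ m₀ : ℕ, 0 < m₀ ∧ ∀ m ≥ m₀, ∀ N : ℕ, 0 < N →
      ∀ βN βN1 : ℝ,
        HasCF βN (betaDigits n m N a) →
        HasCF βN1 (betaDigits n m (N + 1) a) →
        |brjunoPhiMinus n m βN - brjunoPhiMinus n m βN1| < ε / 2 := by
  set A : ℕ := 1 + ∑ i ∈ Finset.range n, a i
  let ι := {p : ℕ × ℕ × ℝ × ℝ // 0 < p.1 ∧ HasCF p.2.2.1 (betaDigits n p.1 p.2.1 a) ∧
    HasCF p.2.2.2 (betaDigits n p.1 (p.2.1 + 1) a)}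
  let l : Filter ι := comap (fun p => p.1.1) atTop
  have hm : Tendsto (fun p : ι => p.1.1) l atTop := tendsto_comap
  have hdiff (k : ℕ) :
      Tendsto (fun p : ι => |alphaIter p.1.2.2.1 k - alphaIter p.1.2.2.2 k|) l (nhds 0) := by
    have hK : Tendsto (fun p : ι => n + p.1.1 - 1 - k) l atTop :=
      (tendsto_atTop_mono (fun m => by omega) (tendsto_sub_atTop_nat (1 + k)) :
        Tendsto (fun m => n + m - 1 - k) atTop atTop).comp hm
    refine squeeze_zero (fun _ => abs_nonneg _) (fun p => ?_)
      (by simpa using ((tendsto_pow_atTop_nhds_zero_of_lt_one (r := (3 / 4 : ℝ))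
        (by norm_num) (by norm_num)).comp hK).const_mul 2)
    refine p.2.2.1.abs_alphaIter_sub_le p.2.2.2 fun j hj => ?_
    have hj' : j + 1 ≠ n + p.1.1 := by omega
    simp only [betaDigits, if_neg hj']
  have hdigit (m N k : ℕ) (hm : 0 < m) (hk : k ≠ n + m - 1) :
      (betaDigits n m N a k : ℝ) ≤ A := by
    exact_mod_cast betaDigits_le_of_ne a (by omega)
  have hlim : Tendsto (fun p : ι => ∑' k, if k = n + p.1.1 - 1 then 0
      else brjunoTerm p.1.2.2.1 k - brjunoTerm p.1.2.2.2 k) l (nhds (∑' _ : ℕ, (0 : ℝ))) := by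
    refine tendsto_tsum_of_dominated_convergence (bound := fun k => 4 * A * (3 / 4 : ℝ) ^ k)
      ((summable_geometric_of_lt_one (by norm_num) (by norm_num)).mul_left _)
      (fun k => ?_) (Eventually.of_forall fun p k => ?_)
    · have hb := ((tendsto_finsetSum (Finset.range k) fun j _ => hdiff j).mul_const
        (A : ℝ)).add ((hdiff k).const_mul ((A : ℝ) + 1))
      simp only [Finset.sum_const_zero, zero_mul, mul_zero, add_zero] at hb
      refine squeeze_zero_norm (fun p => ?_) hb
      split_ifs with hk
      · rw [norm_zero]
        positivity
      · exact p.2.2.1.abs_brjunoTerm_sub_le p.2.2.2 (hdigit _ _ _ p.2.1 hk)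
          (hdigit _ _ _ p.2.1 hk)
    · split_ifs with hk
      · rw [norm_zero]
        positivity
      · have h1 := p.2.2.1.abs_brjunoTerm_le (hdigit _ _ _ p.2.1 hk)
        have h2 := p.2.2.2.abs_brjunoTerm_le (hdigit _ _ _ p.2.1 hk)
        rw [Real.norm_eq_abs]
        linarith [abs_sub (brjunoTerm p.1.2.2.1 k) (brjunoTerm p.1.2.2.2 k)]
  rw [tsum_zero] at hlim
  have hev := hlim.abs.eventually_lt_const (u := ε / 2) (by simpa using half_pos hε)
  obtain ⟨m₁, hm₁⟩ := eventually_atTop.1 (eventually_comap.1 hev)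
  refine ⟨m₁ + 1, m₁.succ_pos, fun m hm N _ βN βN1 h h' => ?_⟩
  rw [brjunoPhiMinus_sub_eq_tsum (summable_brjunoTerm_of_betaDigits h)
    (summable_brjunoTerm_of_betaDigits h')]
  exact hm₁ m (by omega) ⟨(m, N, βN, βN1), by omega, h, h'⟩ rfl
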